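/- arXiv:1203.6668 — 2 statements merged into one kernel-verified Lean document; each statement's English description precedes it below -/
import Mathlib

section
/- Let Z, Z' ∈ Ω_{r,c} with Z ≠ Z' differing only in the 2×2 subsquare on rows i,i' and columns j,j' (a transition e = (Z,Z') of the contingency chain). Then the number of row-good tables X ∈ Ω_{r,c} such that (Z,Z') occurs as a consecutive pair of the canonical walk w_X is at most 12(m−2). -/
open Finset

/-- `X` is a contingency table with row sums `r` and column sums `c`. -/
def IsContingencyTable {m n : ℕ} (r : Fin m → ℕ) (c : Fin n → ℕ)
    (X : Matrix (Fin m) (Fin n) ℕ) : Prop :=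
  (∀ i, ∑ j, X i j = r i) ∧ (∀ j, ∑ i, X i j = c j)

/-- The 5-tuple `(i₁,i₂,i₃,j₁,j₂)` is row-good for `X`: the rows `i₁,i₂,i₃` are distinct,
the columns `j₁,j₂` are distinct, and `X i₁ j₁`, `X i₂ j₁`, `X i₃ j₂` are all positive. -/
def RowGoodTuple {m n : ℕ} (X : Matrix (Fin m) (Fin n) ℕ)
    (t : Fin m × Fin m × Fin m × Fin n × Fin n) : Prop :=
  t.1 ≠ t.2.1 ∧ t.1 ≠ t.2.2.1 ∧ t.2.1 ≠ t.2.2.1 ∧ t.2.2.2.1 ≠ t.2.2.2.2 ∧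
  0 < X t.1 t.2.2.2.1 ∧ 0 < X t.2.1 t.2.2.2.1 ∧ 0 < X t.2.2.1 t.2.2.2.2

/-- The 5-tuples ordered lexicographically. -/
def lex5 {m n : ℕ} (t : Fin m × Fin m × Fin m × Fin n × Fin n) :
    Lex (Fin m × Lex (Fin m × Lex (Fin m × Lex (Fin n × Fin n)))) :=
  toLex (t.1, toLex (t.2.1, toLex (t.2.2.1, toLex (t.2.2.2.1, t.2.2.2.2))))

/-- The first matrix `A(X)` of the canonical walk for the row-good 5-tuple
`(i₁,i₂,i₃,j₁,j₂)`: subtract 1 from entries `(i₁,j₁)` and `(i₃,j₂)` and add 1 to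
entries `(i₁,j₂)` and `(i₃,j₁)`. -/
def rowGoodA {m n : ℕ} (X : Matrix (Fin m) (Fin n) ℕ)
    (t : Fin m × Fin m × Fin m × Fin n × Fin n) : Matrix (Fin m) (Fin n) ℕ :=
  fun k l =>
    if k = t.1 ∧ l = t.2.2.2.1 then X k l - 1
    else if k = t.1 ∧ l = t.2.2.2.2 then X k l + 1
    else if k = t.2.2.1 ∧ l = t.2.2.2.1 then X k l + 1
    else if k = t.2.2.1 ∧ l = t.2.2.2.2 then X k l - 1
    else X k l

/-- The second matrix `B(X)` of the canonical walk for the row-good 5-tuple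
`(i₁,i₂,i₃,j₁,j₂)`: subtract 1 from entries `(i₂,j₁)` and `(i₃,j₂)` and add 1 to
entries `(i₂,j₂)` and `(i₃,j₁)`. -/
def rowGoodB {m n : ℕ} (X : Matrix (Fin m) (Fin n) ℕ)
    (t : Fin m × Fin m × Fin m × Fin n × Fin n) : Matrix (Fin m) (Fin n) ℕ :=
  fun k l =>
    if k = t.2.1 ∧ l = t.2.2.2.1 then X k l - 1
    else if k = t.2.1 ∧ l = t.2.2.2.2 then X k l + 1
    else if k = t.2.2.1 ∧ l = t.2.2.2.1 then X k l + 1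
    else if k = t.2.2.1 ∧ l = t.2.2.2.2 then X k l - 1
    else X k l

theorem rowGoodA_inv {m n : ℕ} (X : Matrix (Fin m) (Fin n) ℕ)
    (t : Fin m × Fin m × Fin m × Fin n × Fin n) (h : RowGoodTuple X t) :
    X = rowGoodA (rowGoodA X t) (t.1, t.1, t.2.2.1, t.2.2.2.2, t.2.2.2.1) := by
  obtain ⟨i1, i2, i3, j1, j2⟩ := t
  obtain ⟨h1, h2, h3, h4, h5, h6, h7⟩ := h
  ext k l
  simp only [rowGoodA] at *
  grind

theorem rowGood_diff {m n : ℕ} (X : Matrix (Fin m) (Fin n) ℕ)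
    (t : Fin m × Fin m × Fin m × Fin n × Fin n) (h : RowGoodTuple X t) :
    rowGoodA X t t.1 t.2.2.2.1 ≠ rowGoodB X t t.1 t.2.2.2.1 ∧
    rowGoodA X t t.2.1 t.2.2.2.2 ≠ rowGoodB X t t.2.1 t.2.2.2.2 := by
  obtain ⟨i1, i2, i3, j1, j2⟩ := t
  obtain ⟨h1, h2, h3, h4, h5, h6, h7⟩ := h
  simp only [rowGoodA, rowGoodB] at *
  grind

/-- Let `Z, Z' ∈ Ω_{r,c}` with `Z ≠ Z'` differ only in the 2×2 subsquare
on rows `i,i'` and columns `j,j'` (a transition `e = (Z,Z')` of the contingency chain).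
Then the number of row-good tables `X ∈ Ω_{r,c}` such that `(Z,Z')` occurs as a
consecutive pair of the canonical walk `w_X = (X, A(X), B(X), X)` — built from the
lexicographically least row-good 5-tuple for `X` — is at most `12(m-2)`. -/
theorem row_good_walk_congestion {m n : ℕ} (r : Fin m → ℕ) (c : Fin n → ℕ)
    (hr : ∀ i, 0 < r i) (hc : ∀ j, 0 < c j)
    (hsum : ∑ i, r i = ∑ j, c j)
    (Z Z' : Matrix (Fin m) (Fin n) ℕ)
    (hZ : IsContingencyTable r c Z) (hZ' : IsContingencyTable r c Z')
    (hne : Z ≠ Z')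
    (i i' : Fin m) (j j' : Fin n) (hii : i ≠ i') (hjj : j ≠ j')
    (hagree : ∀ k l, ((k ≠ i ∧ k ≠ i') ∨ (l ≠ j ∧ l ≠ j')) → Z k l = Z' k l) :
    {X : Matrix (Fin m) (Fin n) ℕ | IsContingencyTable r c X ∧
      ∃ t, RowGoodTuple X t ∧ (∀ t', RowGoodTuple X t' → lex5 t ≤ lex5 t') ∧
        ((Z = X ∧ Z' = rowGoodA X t) ∨ (Z = rowGoodA X t ∧ Z' = rowGoodB X t) ∨
          (Z = rowGoodB X t ∧ Z' = X))}.ncard ≤ 12 * (m - 2) := by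
  classical
  set S := {X : Matrix (Fin m) (Fin n) ℕ | IsContingencyTable r c X ∧
      ∃ t, RowGoodTuple X t ∧ (∀ t', RowGoodTuple X t' → lex5 t ≤ lex5 t') ∧
        ((Z = X ∧ Z' = rowGoodA X t) ∨ (Z = rowGoodA X t ∧ Z' = rowGoodB X t) ∨
          (Z = rowGoodB X t ∧ Z' = X))} with hS
  rcases S.eq_empty_or_nonempty with he | ⟨X0, hX0⟩
  · rw [he]; simp
  have hm : 3 ≤ m := by
    obtain ⟨-, t, ⟨h1, h2, h3, -⟩, -⟩ := hX0
    have := t.1.2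
    have := t.2.1.2
    have := t.2.2.1.2
    have := Fin.val_ne_of_ne h1
    have := Fin.val_ne_of_ne h2
    have := Fin.val_ne_of_ne h3
    omega
  let K : Finset (Fin m) := Finset.univ \ {i, i'}
  have hK : K.card = m - 2 := by
    rw [Finset.card_sdiff_of_subset (Finset.subset_univ _), Finset.card_pair hii]
    simp
  let g : Fin m → Fin n → Fin n → Fin m → Matrix (Fin m) (Fin n) ℕ :=
    fun a b d k => rowGoodA Z (a, a, k, d, b)
  let T : Finset (Matrix (Fin m) (Fin n) ℕ) :=
    {Z, Z'} ∪ ((K.image (g i j j') ∪ K.image (g i' j j')) ∪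
      (K.image (g i j' j) ∪ K.image (g i' j' j)))
  have hsub : S ⊆ (T : Set (Matrix (Fin m) (Fin n) ℕ)) := by
    rintro X ⟨-, t, ht, -, hc⟩
    rw [Finset.mem_coe]
    rcases hc with ⟨h, -⟩ | ⟨hA, hB⟩ | ⟨-, h⟩
    · simp [T, h]
    · have hinv := rowGoodA_inv X t ht
      have hd := rowGood_diff X t ht
      rw [← hA] at hinv hd
      rw [← hB] at hd
      obtain ⟨d1, d2⟩ := hd
      have e1 := mt (hagree _ _) d1
      have e2 := mt (hagree _ _) d2
      obtain ⟨i1, i2, i3, j1, j2⟩ := t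
      obtain ⟨h1, h2, h3, h4, -⟩ := ht
      simp only at *
      have hk : i3 ∈ K := by
        simp only [K, Finset.mem_sdiff, Finset.mem_univ, Finset.mem_insert,
          Finset.mem_singleton, true_and]
        grind
      have hcase : (i1 = i ∨ i1 = i') ∧ ((j1 = j ∧ j2 = j') ∨ (j1 = j' ∧ j2 = j)) := by
        grind
      have hg : ∀ a b d, i1 = a → j1 = b → j2 = d → X ∈ K.image (g a b d) := by
        rintro a b d rfl rfl rfl
        exact Finset.mem_image.2 ⟨i3, hk, hinv.symm⟩
      simp only [T, Finset.mem_union]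
      right
      rcases hcase with ⟨ha | ha, ⟨hb, hd⟩ | ⟨hb, hd⟩⟩
      · exact Or.inl (Or.inl (hg _ _ _ ha hb hd))
      · exact Or.inr (Or.inl (hg _ _ _ ha hb hd))
      · exact Or.inl (Or.inr (hg _ _ _ ha hb hd))
      · exact Or.inr (Or.inr (hg _ _ _ ha hb hd))
    · simp [T, h]
  have h1 : S.ncard ≤ T.card := by
    rw [← Set.ncard_coe_finset T]
    exact Set.ncard_le_ncard hsub T.finite_toSet
  have h2 : T.card ≤ 2 + (((m - 2) + (m - 2)) + ((m - 2) + (m - 2))) := by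
    have hi : ∀ f : Fin m → Matrix (Fin m) (Fin n) ℕ, (K.image f).card ≤ m - 2 :=
      fun f => hK ▸ Finset.card_image_le
    refine (Finset.card_union_le _ _).trans (add_le_add Finset.card_le_two ?_)
    refine (Finset.card_union_le _ _).trans (add_le_add ?_ ?_)
    · exact (Finset.card_union_le _ _).trans (add_le_add (hi _) (hi _))
    · exact (Finset.card_union_le _ _).trans (add_le_add (hi _) (hi _))
  omega
end

section
/- Let r and c satisfy r_1 ≥ ⋯ ≥ r_m, c_1 ≥ ⋯ ≥ c_n, min{m,n} ≥ 2, max{m,n} ≥ 3 and min{r_1,c_1} ≥ 2, and let Z, Z' ∈ Ω_{r,c} with Z ≠ Z' differing only in the 2×2 subsquare on rows i,i' and columns j,j' (a transition e = (Z,Z') of the contingency chain). Then the number of bad tables X ∈ Ω_{r,c} such that (Z,Z') occurs as a consecutive pair of the canonical walk w_X is at most 72(m−2)(n−2). -/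
open Finset

/-- `X` is row-good. -/
def RowGood {m n : ℕ} (X : Matrix (Fin m) (Fin n) ℕ) : Prop :=
  ∃ (i₁ i₂ i₃ : Fin m) (j₁ j₂ : Fin n),
    i₁ ≠ i₂ ∧ i₁ ≠ i₃ ∧ i₂ ≠ i₃ ∧ j₁ ≠ j₂ ∧
    0 < X i₁ j₁ ∧ 0 < X i₂ j₁ ∧ 0 < X i₃ j₂

/-- `X` is column-good. -/
def ColGood {m n : ℕ} (X : Matrix (Fin m) (Fin n) ℕ) : Prop :=
  ∃ (i₁ i₂ : Fin m) (j₁ j₂ j₃ : Fin n),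
    i₁ ≠ i₂ ∧ j₁ ≠ j₂ ∧ j₁ ≠ j₃ ∧ j₂ ≠ j₃ ∧
    0 < X i₁ j₁ ∧ 0 < X i₁ j₂ ∧ 0 < X i₂ j₃

/-- The 6-tuple `(i₁,i₂,i₃,j₁,j₂,j₃)` is a canonical-walk tuple for a bad table `X`:
the rows `i₁,i₂,i₃` are distinct, the columns `j₁,j₂,j₃` are distinct, `X i₁ j₁ ≥ 2`,
and `X i₂ j₂`, `X i₃ j₃` are positive. -/
def BadTuple {m n : ℕ} (X : Matrix (Fin m) (Fin n) ℕ)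
    (t : Fin m × Fin m × Fin m × Fin n × Fin n × Fin n) : Prop :=
  t.1 ≠ t.2.1 ∧ t.1 ≠ t.2.2.1 ∧ t.2.1 ≠ t.2.2.1 ∧
  t.2.2.2.1 ≠ t.2.2.2.2.1 ∧ t.2.2.2.1 ≠ t.2.2.2.2.2 ∧ t.2.2.2.2.1 ≠ t.2.2.2.2.2 ∧
  2 ≤ X t.1 t.2.2.2.1 ∧ 0 < X t.2.1 t.2.2.2.2.1 ∧ 0 < X t.2.2.1 t.2.2.2.2.2

/-- The 6-tuples ordered lexicographically. -/
def lex6 {m n : ℕ} (t : Fin m × Fin m × Fin m × Fin n × Fin n × Fin n) :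
    Lex (Fin m × Lex (Fin m × Lex (Fin m × Lex (Fin n × Lex (Fin n × Fin n))))) :=
  toLex (t.1, toLex (t.2.1, toLex (t.2.2.1,
    toLex (t.2.2.2.1, toLex (t.2.2.2.2.1, t.2.2.2.2.2)))))

/-- The matrix agreeing with `X` outside rows `i₁,i₂,i₃` and columns `j₁,j₂,j₃` whose
3×3 subsquare on those rows and columns is given (row by row) by the nine values. -/
def subsquare3 {m n : ℕ} (X : Matrix (Fin m) (Fin n) ℕ)
    (i₁ i₂ i₃ : Fin m) (j₁ j₂ j₃ : Fin n)
    (y₁₁ y₁₂ y₁₃ y₂₁ y₂₂ y₂₃ y₃₁ y₃₂ y₃₃ : ℕ) : Matrix (Fin m) (Fin n) ℕ :=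
  fun k l =>
    if k = i₁ ∧ l = j₁ then y₁₁
    else if k = i₁ ∧ l = j₂ then y₁₂
    else if k = i₁ ∧ l = j₃ then y₁₃
    else if k = i₂ ∧ l = j₁ then y₂₁
    else if k = i₂ ∧ l = j₂ then y₂₂
    else if k = i₂ ∧ l = j₃ then y₂₃
    else if k = i₃ ∧ l = j₁ then y₃₁
    else if k = i₃ ∧ l = j₂ then y₃₂
    else if k = i₃ ∧ l = j₃ then y₃₃
    else X k l

/-- The four intermediate matrices `X₁, X₂, X₃, X₄` of the canonical closed walk of
length 5 for a bad table `X` with canonical 6-tuple `t = (i₁,i₂,i₃,j₁,j₂,j₃)`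
(writing `y k ℓ = X iₖ jₗ`). -/
def badWalk {m n : ℕ} (X : Matrix (Fin m) (Fin n) ℕ)
    (t : Fin m × Fin m × Fin m × Fin n × Fin n × Fin n) (s : Fin 4) :
    Matrix (Fin m) (Fin n) ℕ :=
  let i₁ := t.1; let i₂ := t.2.1; let i₃ := t.2.2.1
  let j₁ := t.2.2.2.1; let j₂ := t.2.2.2.2.1; let j₃ := t.2.2.2.2.2
  let y₁₁ := X i₁ j₁; let y₂₂ := X i₂ j₂; let y₃₃ := X i₃ j₃
  match s with
  | 0 => subsquare3 X i₁ i₂ i₃ j₁ j₂ j₃ (y₁₁ - 1) 1 0 1 (y₂₂ - 1) 0 0 0 y₃₃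
  | 1 => subsquare3 X i₁ i₂ i₃ j₁ j₂ j₃ (y₁₁ - 1) 1 0 0 (y₂₂ - 1) 1 1 0 (y₃₃ - 1)
  | 2 => subsquare3 X i₁ i₂ i₃ j₁ j₂ j₃ (y₁₁ - 2) 1 1 1 (y₂₂ - 1) 0 1 0 (y₃₃ - 1)
  | 3 => subsquare3 X i₁ i₂ i₃ j₁ j₂ j₃ (y₁₁ - 1) 0 1 0 y₂₂ 0 1 0 (y₃₃ - 1)

set_option linter.unusedSimpArgs false
set_option linter.unusedVariables false
set_option maxHeartbeats 2000000

lemma bw_offdiag {m n : ℕ} {X : Matrix (Fin m) (Fin n) ℕ} {a b d : Fin m} {e f g : Fin n}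
    (hR : ¬ RowGood X) (ht : BadTuple X (a, b, d, e, f, g)) :
    X a f = 0 ∧ X a g = 0 ∧ X b e = 0 ∧ X b g = 0 ∧ X d e = 0 ∧ X d f = 0 := by
  obtain ⟨h1, h2, h3, h4, h5, h6, h7, h8, h9⟩ := ht
  simp only at h1 h2 h3 h4 h5 h6 h7 h8 h9
  refine ⟨?_, ?_, ?_, ?_, ?_, ?_⟩ <;> by_contra h <;> apply hR
  · exact ⟨a, b, d, f, g, h1, h2, h3, h6, by omega, by omega, by omega⟩
  · exact ⟨a, d, b, g, f, h2, h1, h3.symm, h6.symm, by omega, by omega, by omega⟩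
  · exact ⟨a, b, d, e, g, h1, h2, h3, h5, by omega, by omega, by omega⟩
  · exact ⟨b, d, a, g, e, h3, h1.symm, h2.symm, h5.symm, by omega, by omega, by omega⟩
  · exact ⟨a, d, b, e, f, h2, h1, h3.symm, h4, by omega, by omega, by omega⟩
  · exact ⟨b, d, a, f, e, h3, h1.symm, h2.symm, h4.symm, by omega, by omega, by omega⟩

lemma bw_sub_inj {m n : ℕ} {X Y : Matrix (Fin m) (Fin n) ℕ} {a b d : Fin m} {e f g : Fin n}
    {x1 x2 x3 x4 x5 x6 x7 x8 x9 y1 y5 y9 : ℕ}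
    (hX : ¬ RowGood X) (htX : BadTuple X (a, b, d, e, f, g))
    (hY : ¬ RowGood Y) (htY : BadTuple Y (a, b, d, e, f, g))
    (h : subsquare3 X a b d e f g x1 x2 x3 x4 x5 x6 x7 x8 x9 =
      subsquare3 Y a b d e f g y1 x2 x3 x4 y5 x6 x7 x8 y9)
    (h1 : x1 = y1 → X a e = Y a e) (h5 : x5 = y5 → X b f = Y b f)
    (h9 : x9 = y9 → X d g = Y d g) : X = Y := by
  obtain ⟨u1, u2, u3, u4, u5, u6⟩ := bw_offdiag hX htX
  obtain ⟨v1, v2, v3, v4, v5, v6⟩ := bw_offdiag hY htY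
  obtain ⟨d1, d2, d3, d4, d5, d6, -⟩ := htX
  simp only at d1 d2 d3 d4 d5 d6
  have k1 := congrFun (congrFun h a) e
  have k5 := congrFun (congrFun h b) f
  have k9 := congrFun (congrFun h d) g
  simp [subsquare3, d1, d2, d3, d4, d5, d6, d1.symm, d2.symm, d3.symm, d4.symm, d5.symm,
    d6.symm] at k1 k5 k9
  have k1 := h1 k1
  have k5 := h5 k5
  have k9 := h9 k9
  ext k l
  have hk := congrFun (congrFun h k) l
  simp only [subsquare3] at hk
  split_ifs at hk <;> grind

lemma bw_inj {m n : ℕ} {X Y : Matrix (Fin m) (Fin n) ℕ} (s : Fin 4)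
    {t : Fin m × Fin m × Fin m × Fin n × Fin n × Fin n}
    (hX : ¬ RowGood X) (htX : BadTuple X t)
    (hY : ¬ RowGood Y) (htY : BadTuple Y t)
    (h : badWalk X t s = badWalk Y t s) : X = Y := by
  obtain ⟨a, b, d, e, f, g⟩ := t
  have q1 := htX.2.2.2.2.2.2
  have q2 := htY.2.2.2.2.2.2
  simp only at q1 q2
  fin_cases s <;> simp only [badWalk] at h <;>
    exact bw_sub_inj hX htX hY htY h (by omega) (by omega) (by omega)

/-- Candidate tuples. -/
def bwTup {m n : ℕ} (i i' : Fin m) (j j' : Fin n)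
    (p : Fin 3 × Bool × Bool × Fin m × Fin n) : Fin m × Fin m × Fin m × Fin n × Fin n × Fin n :=
  let a := if p.2.1 then i else i'
  let b := if p.2.1 then i' else i
  let d := if p.2.2.1 then j else j'
  let e := if p.2.2.1 then j' else j
  let k := p.2.2.2.1
  let l := p.2.2.2.2
  match p.1 with
  | 0 => (k, a, b, d, l, e)
  | 1 => (a, b, k, d, l, e)
  | 2 => (a, b, k, d, e, l)

/-- Source index of the step. -/
def bwIdx (s : Fin 3) : Fin 4 := s.castSucc

lemma bw_card {m : ℕ} {i i' : Fin m} (h : i ≠ i') : (({i, i'} : Finset (Fin m))ᶜ).card = m - 2 := by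
  rw [Finset.card_compl, Finset.card_pair h, Fintype.card_fin]

lemma bw_cover {m n : ℕ} {a a' i i' : Fin m} {b b' j j' : Fin n} (ha : a ≠ a') (hb : b ≠ b')
    (h1 : ¬ ((a ≠ i ∧ a ≠ i') ∨ (b ≠ j ∧ b ≠ j')))
    (h2 : ¬ ((a' ≠ i ∧ a' ≠ i') ∨ (b' ≠ j ∧ b' ≠ j'))) :
    (∃ x : Bool, a = (if x then i else i') ∧ a' = if x then i' else i) ∧
    (∃ x : Bool, b = (if x then j else j') ∧ b' = if x then j' else j) := by
  constructor
  · rcases eq_or_ne a i with h | h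
    · exact ⟨true, by grind⟩
    · exact ⟨false, by grind⟩
  · rcases eq_or_ne b j with h | h
    · exact ⟨true, by grind⟩
    · exact ⟨false, by grind⟩

lemma bw_cover2 {m n : ℕ} {a a' i i' : Fin m} {b b' j j' : Fin n} (ha : a ≠ a') (hb : b ≠ b')
    (h1 : ¬ ((a ≠ i ∧ a ≠ i') ∨ (b' ≠ j ∧ b' ≠ j')))
    (h2 : ¬ ((a' ≠ i ∧ a' ≠ i') ∨ (b ≠ j ∧ b ≠ j'))) :
    (∃ x : Bool, a = (if x then i else i') ∧ a' = if x then i' else i) ∧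
    (∃ x : Bool, b = (if x then j else j') ∧ b' = if x then j' else j) := by
  rw [not_or] at h1 h2
  exact bw_cover ha hb (not_or.2 ⟨h1.1, h2.2⟩) (not_or.2 ⟨h2.1, h1.2⟩)

/-- Let `r` and `c` be sorted vectors of positive integers with a common
sum, with `min{m,n} ≥ 2`, `max{m,n} ≥ 3` and `min{r₁,c₁} ≥ 2`, and let `Z, Z' ∈ Ω_{r,c}`
with `Z ≠ Z'` differ only in the 2×2 subsquare on rows `i,i'` and columns `j,j'` (a
transition `e = (Z,Z')` of the contingency chain).  Then the number of bad tables
`X ∈ Ω_{r,c}` such that `(Z,Z')` occurs as a consecutive pair of the canonical walk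
`w_X = (X, X₁, X₂, X₃, X₄, X)` — built from the lexicographically least 6-tuple for `X` —
is at most `72(m-2)(n-2)`. -/
theorem bad_walk_congestion {m n : ℕ} (r : Fin m → ℕ) (c : Fin n → ℕ)
    (hr : ∀ i, 0 < r i) (hc : ∀ j, 0 < c j)
    (hsum : ∑ i, r i = ∑ j, c j)
    (hrmono : Antitone r) (hcmono : Antitone c)
    (hm : 2 ≤ m) (hn : 2 ≤ n) (hmax : 3 ≤ max m n)
    (hr1 : 2 ≤ r ⟨0, by omega⟩) (hc1 : 2 ≤ c ⟨0, by omega⟩)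
    (Z Z' : Matrix (Fin m) (Fin n) ℕ)
    (hZ : IsContingencyTable r c Z) (hZ' : IsContingencyTable r c Z')
    (hne : Z ≠ Z')
    (i i' : Fin m) (j j' : Fin n) (hii : i ≠ i') (hjj : j ≠ j')
    (hagree : ∀ k l, ((k ≠ i ∧ k ≠ i') ∨ (l ≠ j ∧ l ≠ j')) → Z k l = Z' k l) :
    {X : Matrix (Fin m) (Fin n) ℕ | IsContingencyTable r c X ∧
      ¬ RowGood X ∧ ¬ ColGood X ∧
      ∃ t, BadTuple X t ∧ (∀ t', BadTuple X t' → lex6 t ≤ lex6 t') ∧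
        ((Z = X ∧ Z' = badWalk X t 0) ∨ (Z = badWalk X t 0 ∧ Z' = badWalk X t 1) ∨
         (Z = badWalk X t 1 ∧ Z' = badWalk X t 2) ∨
         (Z = badWalk X t 2 ∧ Z' = badWalk X t 3) ∨
         (Z = badWalk X t 3 ∧ Z' = X))}.ncard ≤ 72 * (m - 2) * (n - 2) := by
  classical
  set P : Finset (Fin 3 × Bool × Bool × Fin m × Fin n) :=
    univ ×ˢ univ ×ˢ univ ×ˢ ({i, i'} : Finset (Fin m))ᶜ ×ˢ ({j, j'} : Finset (Fin n))ᶜ with hP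
  have hPc : P.card = 12 * ((m - 2) * (n - 2)) := by
    simp only [hP, Finset.card_product, bw_card hii, bw_card hjj, Finset.card_univ,
      Fintype.card_fin, Fintype.card_bool]
    ring
  let Q : Fin 3 × Bool × Bool × Fin m × Fin n → Matrix (Fin m) (Fin n) ℕ → Prop :=
    fun p X => ¬ RowGood X ∧ BadTuple X (bwTup i i' j j' p) ∧
      Z = badWalk X (bwTup i i' j j' p) (bwIdx p.1)
  have hQ : ∀ p X Y, Q p X → Q p Y → X = Y := by
    rintro p X Y ⟨h1, h2, h3⟩ ⟨h4, h5, h6⟩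
    exact bw_inj _ h1 h2 h4 h5 (h3.symm.trans h6)
  let G : Fin 3 × Bool × Bool × Fin m × Fin n → Matrix (Fin m) (Fin n) ℕ :=
    fun p => if h : ∃ X, Q p X then h.choose else Z
  have hG : ∀ p X, Q p X → X = G p := by
    intro p X h
    have h' : ∃ X, Q p X := ⟨X, h⟩
    simp only [G, dif_pos h']
    exact hQ p _ _ h h'.choose_spec
  have hmem : ∀ s x y k l, k ∉ ({i, i'} : Finset (Fin m)) → l ∉ ({j, j'} : Finset (Fin n)) →
      ((s, x, y, k, l) : Fin 3 × Bool × Bool × Fin m × Fin n) ∈ P := by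
    intro s x y k l h1 h2
    simp only [hP, Finset.mem_product, Finset.mem_univ, true_and, Finset.mem_compl]
    exact ⟨h1, h2⟩
  have hag : ∀ k l, Z k l ≠ Z' k l → ¬ ((k ≠ i ∧ k ≠ i') ∨ (l ≠ j ∧ l ≠ j')) :=
    fun k l h h' => h (hagree k l h')
  set S := {X : Matrix (Fin m) (Fin n) ℕ | IsContingencyTable r c X ∧
      ¬ RowGood X ∧ ¬ ColGood X ∧
      ∃ t, BadTuple X t ∧ (∀ t', BadTuple X t' → lex6 t ≤ lex6 t') ∧
        ((Z = X ∧ Z' = badWalk X t 0) ∨ (Z = badWalk X t 0 ∧ Z' = badWalk X t 1) ∨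
         (Z = badWalk X t 1 ∧ Z' = badWalk X t 2) ∨
         (Z = badWalk X t 2 ∧ Z' = badWalk X t 3) ∨
         (Z = badWalk X t 3 ∧ Z' = X))} with hS
  rcases S.eq_empty_or_nonempty with h0 | ⟨X0, hX0⟩
  · rw [h0]; simp
  have hm3 : 1 ≤ m - 2 ∧ 1 ≤ n - 2 := by
    obtain ⟨-, -, -, ⟨a, b, d, e, f, g⟩, ⟨h1, h2, h3, h4, h5, h6, -⟩, -⟩ := hX0
    simp only at h1 h2 h3 h4 h5 h6
    omega
  have hsub : S ⊆ (({Z, Z'} ∪ P.image G : Finset (Matrix (Fin m) (Fin n) ℕ)) : Set _) := by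
    rintro X ⟨-, hR, -, ⟨a, b, d, e, f, g⟩, ht, -, hw⟩
    have ht' := ht
    obtain ⟨d1, d2, d3, d4, d5, d6, d7, d8, d9⟩ := ht'
    simp only at d1 d2 d3 d4 d5 d6 d7 d8 d9
    simp only [Finset.coe_union, Set.mem_union, Finset.mem_coe, Finset.mem_insert,
      Finset.mem_singleton, Finset.mem_image]
    rcases hw with ⟨h, -⟩ | ⟨h, h'⟩ | ⟨h, h'⟩ | ⟨h, h'⟩ | ⟨-, h⟩
    · exact Or.inl (Or.inl h.symm)
    · right
      have e1 : Z b e ≠ Z' b e := by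
        rw [h, h']
        simp [badWalk, subsquare3, d1.symm, d2.symm, d3.symm, d4.symm, d5.symm, d6.symm, d1, d2, d3, d4, d5, d6]
      have e2 : Z d g ≠ Z' d g := by
        rw [h, h']
        simp [badWalk, subsquare3, d1.symm, d2.symm, d3.symm, d4.symm, d5.symm, d6.symm, d1, d2, d3, d4, d5, d6]
        omega
      obtain ⟨⟨x, x1, x2⟩, ⟨y, y1, y2⟩⟩ := bw_cover d3 d5 (hag _ _ e1) (hag _ _ e2)
      refine ⟨(0, x, y, a, f), hmem _ _ _ _ _ (by cases x <;> grind) (by cases y <;> grind), ?_⟩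
      have hT : bwTup i i' j j' (0, x, y, a, f) = (a, b, d, e, f, g) := by
        simp only [bwTup, ← x1, ← x2, ← y1, ← y2]
      exact (hG _ _ ⟨hR, by rw [hT]; exact ht, by rw [hT]; exact h⟩).symm
    · right
      have e1 : Z a g ≠ Z' a g := by
        rw [h, h']
        simp [badWalk, subsquare3, d1.symm, d2.symm, d3.symm, d4.symm, d5.symm, d6.symm, d1, d2, d3, d4, d5, d6]
      have e2 : Z b e ≠ Z' b e := by
        rw [h, h']
        simp [badWalk, subsquare3, d1.symm, d2.symm, d3.symm, d4.symm, d5.symm, d6.symm, d1, d2, d3, d4, d5, d6]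
      obtain ⟨⟨x, x1, x2⟩, ⟨y, y1, y2⟩⟩ :=
        bw_cover2 d1 d5 (hag _ _ e1) (hag _ _ e2)
      refine ⟨(1, x, y, d, f), hmem _ _ _ _ _ (by cases x <;> grind) (by cases y <;> grind), ?_⟩
      have hT : bwTup i i' j j' (1, x, y, d, f) = (a, b, d, e, f, g) := by
        simp only [bwTup, ← x1, ← x2, ← y1, ← y2]
      exact (hG _ _ ⟨hR, by rw [hT]; exact ht, by rw [hT]; exact h⟩).symm
    · right
      have e1 : Z a f ≠ Z' a f := by
        rw [h, h']
        simp [badWalk, subsquare3, d1.symm, d2.symm, d3.symm, d4.symm, d5.symm, d6.symm, d1, d2, d3, d4, d5, d6]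
      have e2 : Z b e ≠ Z' b e := by
        rw [h, h']
        simp [badWalk, subsquare3, d1.symm, d2.symm, d3.symm, d4.symm, d5.symm, d6.symm, d1, d2, d3, d4, d5, d6]
      obtain ⟨⟨x, x1, x2⟩, ⟨y, y1, y2⟩⟩ :=
        bw_cover2 d1 d4 (hag _ _ e1) (hag _ _ e2)
      refine ⟨(2, x, y, d, g), hmem _ _ _ _ _ (by cases x <;> grind) (by cases y <;> grind), ?_⟩
      have hT : bwTup i i' j j' (2, x, y, d, g) = (a, b, d, e, f, g) := by
        simp only [bwTup, ← x1, ← x2, ← y1, ← y2]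
      exact (hG _ _ ⟨hR, by rw [hT]; exact ht, by rw [hT]; exact h⟩).symm
    · exact Or.inl (Or.inr h.symm)
  have h1 : S.ncard ≤ ({Z, Z'} ∪ P.image G : Finset (Matrix (Fin m) (Fin n) ℕ)).card := by
    rw [← Set.ncard_coe_finset]
    exact Set.ncard_le_ncard hsub (Finset.finite_toSet _)
  have h2 := Finset.card_union_le {Z, Z'} (P.image G)
  have h3 := Finset.card_image_le (s := P) (f := G)
  have h4 := Finset.card_le_two (a := Z) (b := Z')
  have h5 : 1 ≤ (m - 2) * (n - 2) := Nat.mul_le_mul hm3.1 hm3.2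
  rw [mul_assoc]
  omega
end
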